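/- Positivity of the cross-partial (key step of Theorem 1): Let h₀ ∈ (0,1), β > 0, δ ∈ (0,1), v_H > v_L, and α_H > α_L. Define h(e) = h₀·exp(−β·e) and g(e) = ((1−h(e))·(v_H − v_L) − h(e)·(α_H − α_L))/(1 − δ·(1−h(e))). Then g'(e) > 0 for every e; equivalently, g is strictly increasing on ℝ. -/

import Mathlib

/-- Positivity of the cross-partial (key step of Theorem 1): with
`h(e) = h₀·exp(−βe)` and
`g(e) = ((1−h(e))(v_H − v_L) − h(e)(α_H − α_L))/(1 − δ(1−h(e)))`,
the derivative of `g` is strictly positive everywhere; equivalently, `g` is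
strictly increasing on `ℝ`. -/
theorem cross_partial_positive
    (h₀ β δ vH vL aH aL : ℝ)
    (hh₀ : h₀ ∈ Set.Ioo (0 : ℝ) 1) (hβ : 0 < β) (hδ : δ ∈ Set.Ioo (0 : ℝ) 1)
    (hv : vL < vH) (ha : aL < aH) :
    (∀ e : ℝ,
        0 < deriv
          (fun e : ℝ =>
            ((1 - h₀ * Real.exp (-β * e)) * (vH - vL) -
                h₀ * Real.exp (-β * e) * (aH - aL)) /
              (1 - δ * (1 - h₀ * Real.exp (-β * e)))) e) ∧
      StrictMono
        (fun e : ℝ =>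
          ((1 - h₀ * Real.exp (-β * e)) * (vH - vL) -
              h₀ * Real.exp (-β * e) * (aH - aL)) /
            (1 - δ * (1 - h₀ * Real.exp (-β * e)))) := by
  have key : ∀ e : ℝ,
        0 < deriv
          (fun e : ℝ =>
            ((1 - h₀ * Real.exp (-β * e)) * (vH - vL) -
                h₀ * Real.exp (-β * e) * (aH - aL)) /
              (1 - δ * (1 - h₀ * Real.exp (-β * e)))) e := by
    intro e
    obtain ⟨h0, h1⟩ := hh₀
    obtain ⟨d0, d1⟩ := hδ
    have hE := Real.exp_pos (-β * e)
    have hD : 0 < 1 - δ * (1 - h₀ * Real.exp (-β * e)) := by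
      have : 0 < δ * (h₀ * Real.exp (-β * e)) := by positivity
      linarith
    have hlin : HasDerivAt (fun e : ℝ => -β * e) (-β) e := by
      simpa using (hasDerivAt_id e).const_mul (-β)
    have hh : HasDerivAt (fun e : ℝ => h₀ * Real.exp (-β * e))
        (h₀ * (Real.exp (-β * e) * -β)) e := hlin.exp.const_mul h₀
    have hg := (((hh.const_sub 1).mul_const (vH - vL)).sub
      (hh.mul_const (aH - aL))).div (((hh.const_sub 1).const_mul δ).const_sub 1) hD.ne'
    have hd := hg.deriv
    refine lt_of_lt_of_eq ?_ hd.symm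
    apply div_pos _ (by positivity)
    have hV : 0 < vH - vL := sub_pos.2 hv
    have hA : 0 < aH - aL := sub_pos.2 ha
    have hd1 : 0 < 1 - δ := sub_pos.2 d1
    have hp : 0 < β * (h₀ * Real.exp (-β * e)) *
        (((vH - vL) + (aH - aL)) * (1 - δ) + δ * (vH - vL)) := by positivity
    refine lt_of_lt_of_eq hp ?_
    simp only [Pi.sub_apply]
    ring
  exact ⟨key, strictMono_of_deriv_pos key⟩
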